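/- In the group G = F ⋊_φ ℤ/4 of Example 6.2, the subgroup L₁ (the image in G of the subgroup of F generated by x₀, x₁ and x₂) has weak width 4 in G: (a) there exist four elements g₁, g₂, g₃, g₄ of G lying in pairwise distinct double cosets of L₁ such that L₁ ∩ gᵢ⁻¹L₁gᵢ is infinite for each i ∈ {1,2,3,4}; and (b) for any five elements g₁,…,g₅ of G lying in pairwise distinct double cosets of L₁, at least one of the intersections L₁ ∩ gᵢ⁻¹L₁gᵢ is finite. -/

import Mathlib

noncomputable section

/-- The free group on basis `{x_i : i ∈ ℤ/4}`. -/
abbrev F : Type := FreeGroup (ZMod 4)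

/-- The action of `ℤ/4` on `F` permuting the basis by `x_i ↦ x_{i+k}`. -/
def φ : Multiplicative (ZMod 4) →* MulAut F where
  toFun k := (FreeGroup.freeGroupCongr (Equiv.addRight (Multiplicative.toAdd k)) : F ≃* F)
  map_one' := by
    ext x
    simp
  map_mul' a b := by
    have h : (fun i : ZMod 4 => i + Multiplicative.toAdd (a * b)) =
        ((fun i : ZMod 4 => i + Multiplicative.toAdd a) ∘
          fun i : ZMod 4 => i + Multiplicative.toAdd b) := by
      funext i
      show i + (Multiplicative.toAdd a + Multiplicative.toAdd b) =
        i + Multiplicative.toAdd b + Multiplicative.toAdd a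
      abel
    ext x
    rw [MulAut.mul_apply]
    show FreeGroup.map _ x = FreeGroup.map _ (FreeGroup.map _ x)
    rw [FreeGroup.map.comp]
    exact congrArg (fun f => FreeGroup.map f x) h

/-- The group `G = F ⋊ ℤ/4` of Examples 6.1 and 6.2. -/
abbrev G : Type := F ⋊[φ] Multiplicative (ZMod 4)

/-- The conjugate subgroup `g⁻¹ H g = {g⁻¹ h g : h ∈ H}`. -/
def conjSub {G : Type*} [Group G] (g : G) (H : Subgroup G) : Subgroup G :=
  H.map (MulAut.conj g⁻¹).toMonoidHom

/-- `a` lies in the double coset `H b H`. -/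
def inDoubleCoset {G : Type*} [Group G] (H : Subgroup G) (a b : G) : Prop :=
  ∃ h₁ ∈ H, ∃ h₂ ∈ H, a = h₁ * b * h₂

/-- The subgroup `L₁ = ⟨x₀, x₁, x₂⟩` of Example 6.2, viewed inside `G`. -/
def L₁ : Subgroup G :=
  Subgroup.map (SemidirectProduct.inl : F →* G)
    (Subgroup.closure {FreeGroup.of (0 : ZMod 4), FreeGroup.of 1, FreeGroup.of 2})

namespace FreeGroup

variable {α : Type*}

theorem isReduced_append_of_fst_ne {w₁ w₂ : List (α × Bool)} (h₁ : IsReduced w₁)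
    (h₂ : IsReduced w₂) (h : ∀ x ∈ w₁.getLast?, ∀ y ∈ w₂.head?, x.1 ≠ y.1) :
    IsReduced (w₁ ++ w₂) :=
  List.IsChain.append h₁ h₂ fun x hx y hy e => absurd e (h x hx y hy)

theorem mk_singleton_mem_closure {A : Set α} {s : α × Bool} (hs : s.1 ∈ A) :
    mk [s] ∈ Subgroup.closure (of '' A) := by
  obtain ⟨i, b⟩ := s
  have hi : of i ∈ Subgroup.closure (of '' A) := Subgroup.subset_closure ⟨i, hs, rfl⟩
  cases b
  · exact inv_mem hi
  · exact hi

variable [DecidableEq α]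

theorem fst_mem_of_mem_closure {A : Set α} {a : FreeGroup α}
    (ha : a ∈ Subgroup.closure (of '' A)) : ∀ s ∈ a.toWord, s.1 ∈ A := by
  induction ha using Subgroup.closure_induction with
  | mem x hx =>
    obtain ⟨i, hi, rfl⟩ := hx
    simpa using hi
  | one => simp
  | mul x y _ _ hx hy =>
    intro s hs
    rcases List.mem_append.1 ((toWord_mul_sublist x y).subset hs) with h | h
    · exact hx s h
    · exact hy s h
  | inv x _ hx =>
    intro s hs
    rw [toWord_inv] at hs
    simp only [invRev, List.mem_reverse, List.mem_map] at hs
    obtain ⟨t, ht, rfl⟩ := hs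
    exact hx t ht

/-- If a nontrivial element of the subgroup generated by the basis elements in `A` is conjugated
by `h` into the one generated by the basis elements in `B`, then `h` is in the product of the two
subgroups. -/
theorem exists_eq_mul_of_mul_eq_mul {A B : Set α} {h a b : FreeGroup α}
    (ha : a ∈ Subgroup.closure (of '' A)) (ha1 : a ≠ 1) (hb : b ∈ Subgroup.closure (of '' B))
    (e : a * h = h * b) :
    ∃ u ∈ Subgroup.closure (of '' A), ∃ v ∈ Subgroup.closure (of '' B), h = u * v := by
  suffices key : ∀ n (w : List (α × Bool)), w.length = n → IsReduced w → ∀ a b : FreeGroup α,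
      a ∈ Subgroup.closure (of '' A) → a ≠ 1 → b ∈ Subgroup.closure (of '' B) →
      a * mk w = mk w * b →
      ∃ u ∈ Subgroup.closure (of '' A), ∃ v ∈ Subgroup.closure (of '' B), mk w = u * v by
    have := key _ h.toWord rfl isReduced_toWord a b ha ha1 hb (by rwa [mk_toWord])
    rwa [mk_toWord] at this
  intro n
  induction n with
  | zero =>
    intro w hw _ a b _ _ _ _
    obtain rfl := List.length_eq_zero_iff.1 hw
    exact ⟨1, one_mem _, 1, one_mem _, by rw [mul_one]; rfl⟩
  | succ n ih =>
    intro w hw hred a b ha ha1 hb e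
    by_cases hA : ∃ s w', w = s :: w' ∧ s.1 ∈ A
    · obtain ⟨s, w', rfl, hs⟩ := hA
      have hx := mk_singleton_mem_closure hs
      have hm : mk (s :: w') = mk [s] * mk w' := by rw [mul_mk]; rfl
      rw [hm] at e
      obtain ⟨u, hu, v, hv, huv⟩ := ih w' (by simpa using hw)
        (List.IsChain.right_of_append (l₁ := [s]) hred) ((mk [s])⁻¹ * a * mk [s]) b
        (mul_mem (mul_mem (inv_mem hx) ha) hx)
        (fun h => ha1 (by
          rwa [mul_eq_one_iff_eq_inv, inv_mul_eq_iff_eq_mul, mul_inv_cancel] at h)) hb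
        (by rw [mul_assoc, mul_assoc, e]; group)
      exact ⟨mk [s] * u, mul_mem hx hu, v, hv, by rw [hm, huv, mul_assoc]⟩
    by_cases hB : ∃ w' s, w = w' ++ [s] ∧ s.1 ∈ B
    · obtain ⟨w', s, rfl, hs⟩ := hB
      have hx := mk_singleton_mem_closure hs
      rw [← mul_mk] at e
      obtain ⟨u, hu, v, hv, huv⟩ := ih w' (by simpa using hw)
        (List.IsChain.left_of_append hred) a (mk [s] * b * (mk [s])⁻¹) ha ha1
        (mul_mem (mul_mem hx hb) (inv_mem hx))
        (by rw [← mul_assoc, ← mul_assoc, eq_mul_inv_iff_mul_eq, mul_assoc, e])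
      exact ⟨u, hu, v * mk [s], mul_mem hv hx, by rw [← mul_mk, huv, mul_assoc]⟩
    exfalso
    have h1 : IsReduced (a.toWord ++ w) := by
      refine isReduced_append_of_fst_ne isReduced_toWord hred fun x hx y hy hxy => hA ?_
      obtain ⟨w', rfl⟩ := List.head?_eq_some_iff.1 hy
      exact ⟨y, w', rfl, hxy ▸ fst_mem_of_mem_closure ha x (List.mem_of_getLast? hx)⟩
    have h2 : IsReduced (w ++ b.toWord) := by
      refine isReduced_append_of_fst_ne hred isReduced_toWord fun x hx y hy hxy => hB ?_
      obtain ⟨w', rfl⟩ := List.getLast?_eq_some_iff.1 hx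
      exact ⟨w', x, rfl, hxy ▸ fst_mem_of_mem_closure hb y (List.mem_of_head? hy)⟩
    have e' : a.toWord ++ w = w ++ b.toWord := by
      have := congrArg toWord e
      rwa [toWord_mul, toWord_mul, toWord_mk, hred.reduce_eq, h1.reduce_eq, h2.reduce_eq] at this
    obtain ⟨c, l, hc⟩ := List.exists_cons_of_ne_nil (mt toWord_eq_nil_iff.1 ha1)
    obtain ⟨s, w', rfl⟩ := List.exists_cons_of_length_eq_add_one hw
    rw [hc] at e'
    obtain rfl : c = s := by simpa using congrArg List.head? e'
    exact hA ⟨c, w', rfl, fst_mem_of_mem_closure ha c (by simp [hc])⟩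

end FreeGroup

open SemidirectProduct

theorem φ_of (k : Multiplicative (ZMod 4)) (i : ZMod 4) :
    φ k (FreeGroup.of i) = FreeGroup.of (i + Multiplicative.toAdd k) :=
  FreeGroup.map.of

theorem L₁_eq_map_closure_image :
    L₁ = (Subgroup.closure (FreeGroup.of '' ({0, 1, 2} : Set (ZMod 4)))).map (inl : F →* G) := by
  simp only [L₁, Set.image_insert_eq, Set.image_singleton]

theorem right_eq_one_of_mem_L₁ {g : G} (hg : g ∈ L₁) : g.right = 1 := by
  obtain ⟨f, _, rfl⟩ := hg
  rfl

theorem right_eq_of_inDoubleCoset_L₁ {g g' : G} (h : inDoubleCoset L₁ g g') :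
    g.right = g'.right := by
  obtain ⟨a, ha, b, hb, rfl⟩ := h
  simp [right_eq_one_of_mem_L₁ ha, right_eq_one_of_mem_L₁ hb]

theorem φ_mem_closure {A : Set (ZMod 4)} {f : F} (k : Multiplicative (ZMod 4))
    (hf : f ∈ Subgroup.closure (FreeGroup.of '' A)) :
    φ k f ∈ Subgroup.closure (FreeGroup.of '' ((· + Multiplicative.toAdd k) '' A)) := by
  have := Subgroup.mem_map_of_mem (φ k).toMonoidHom hf
  rw [MonoidHom.map_closure, Set.image_image] at this
  rw [Set.image_image]
  simpa only [MulEquiv.coe_toMonoidHom, φ_of] using this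

theorem exists_eq_mul_inr_mul_of_infinite {g : G} (hg : Infinite ↥(L₁ ⊓ conjSub g L₁)) :
    ∃ a ∈ L₁, ∃ b ∈ L₁, g = a * inr g.right * b := by
  obtain ⟨⟨y, hyL, hyg⟩, hy1⟩ := exists_ne (1 : ↥(L₁ ⊓ conjSub g L₁))
  rw [L₁_eq_map_closure_image] at hyL hyg ⊢
  obtain ⟨b, hb, rfl⟩ := hyL
  obtain ⟨_, ⟨a, ha, rfl⟩, hab⟩ := hyg
  have e : (inl a : G) * g = g * inl b := by
    rw [← hab]
    simp [mul_assoc]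
  have e' : a * g.left = g.left * φ g.right b := by
    simpa using congrArg SemidirectProduct.left e
  have ha1 : a ≠ 1 := by
    rintro rfl
    refine hy1 (Subtype.ext ?_)
    simpa using hab.symm
  obtain ⟨u, hu, v, hv, huv⟩ :=
    FreeGroup.exists_eq_mul_of_mul_eq_mul ha ha1 (φ_mem_closure g.right hb) e'
  have hv' := φ_mem_closure g.right⁻¹ hv
  simp only [Set.image_image, toAdd_inv, add_neg_cancel_right, Set.image_id'] at hv'
  refine ⟨_, ⟨u, hu, rfl⟩, _, ⟨_, hv', rfl⟩, ?_⟩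
  ext
  · simp [huv]
  · simp

theorem infinite_L₁_inf_conjSub_inr (k : Multiplicative (ZMod 4)) :
    Infinite ↥(L₁ ⊓ conjSub (inr k : G) L₁) := by
  have hk : ∀ k : ZMod 4, ∃ i : ZMod 4, (i = 0 ∨ i = 1 ∨ i = 2) ∧
      (i + k = 0 ∨ i + k = 1 ∨ i + k = 2) := by decide
  obtain ⟨i, hi, hik⟩ := hk (Multiplicative.toAdd k)
  have mem : ∀ j : ZMod 4, j = 0 ∨ j = 1 ∨ j = 2 → (inl (FreeGroup.of j) : G) ∈ L₁ := by
    intro j hj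
    refine Subgroup.mem_map_of_mem _ (Subgroup.subset_closure ?_)
    rcases hj with rfl | rfl | rfl <;> simp
  have hmem : (inl (FreeGroup.of i) : G) ∈ L₁ ⊓ conjSub (inr k : G) L₁ := by
    refine ⟨mem i hi, _, mem _ hik, ?_⟩
    rw [← φ_of, inl_aut]
    simp [mul_assoc]
  refine Infinite.of_injective (fun n : ℕ => (⟨_, pow_mem hmem n⟩ : ↥(L₁ ⊓ conjSub (inr k) L₁)))
    fun m n h => ?_
  have h' : (inl (FreeGroup.of i ^ m) : G) = inl (FreeGroup.of i ^ n) := by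
    simpa using h
  simpa using congrArg FreeGroup.norm (inl_injective h')

theorem stmt16 :
    (∃ g : Fin 4 → G,
      (∀ i j, i ≠ j → ¬ inDoubleCoset L₁ (g i) (g j)) ∧
      ∀ i, Infinite ↥(L₁ ⊓ conjSub (g i) L₁)) ∧
    (∀ g : Fin 5 → G,
      (∀ i j, i ≠ j → ¬ inDoubleCoset L₁ (g i) (g j)) →
      ∃ i, Finite ↥(L₁ ⊓ conjSub (g i) L₁)) := by
  refine ⟨⟨fun i => inr (Multiplicative.ofAdd (i : ZMod 4)), fun i j hij h => hij ?_,
    fun i => infinite_L₁_inf_conjSub_inr _⟩, fun g hg => ?_⟩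
  · exact Multiplicative.ofAdd.injective (right_eq_of_inDoubleCoset_L₁ h)
  · by_contra! hinf
    obtain ⟨i, j, hij, h⟩ := Fintype.exists_ne_map_eq_of_card_lt
      (fun i : Fin 5 => (g i).right) (by simp [ZMod.card])
    obtain ⟨a, ha, b, hb, hi⟩ := exists_eq_mul_inr_mul_of_infinite (hinf i)
    obtain ⟨c, hc, d, hd, hj⟩ := exists_eq_mul_inr_mul_of_infinite (hinf j)
    refine hg i j hij ⟨a * c⁻¹, mul_mem ha (inv_mem hc), d⁻¹ * b, mul_mem (inv_mem hd) hb, ?_⟩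
    rw [hi, hj, show (g i).right = (g j).right from h]
    simp [mul_assoc]
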